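/- arXiv:2110.09683 — 2 statements merged into one kernel-verified Lean document; each statement's English description precedes it below -/
import Mathlib

section
/- Let n ∈ ℝ⁴ be a unit timelike vector (η(n,n) = 1), let V : ℝⁿ → ℝ be smooth, and let f, g : ℝ × ℝⁿ → ℝ be smooth functions of (σ,q) satisfying the classical Hamilton–Jacobi and continuity equations: ∂_σ f + (1/2) Σ_a (∂f/∂q^a)² + V = 0 and ∂_σ g + Σ_a ∂/∂q^a ( g ∂f/∂q^a ) = 0. Define S^μ(x,q) := f(η(n,x), q) n^μ and ρ(x,q) := g(η(n,x), q). Then: (i) S solves the DeDonder–Weyl Hamilton–Jacobi equation Σ_μ ∂S^μ/∂x^μ + (1/2) Σ_a Σ_{μ,ν} η_{μν} (∂S^μ/∂q^a)(∂S^ν/∂q^a) + V = 0; (ii) for each μ, ρ solves the continuity equation ∂ρ/∂x^μ + Σ_a ∂/∂q^a ( ρ ∂S_μ/∂q^a ) = 0; and (iii) the integrability conditions hold: for all a, μ, ν, ∂/∂x^ν (∂S_μ/∂q^a) − ∂/∂x^μ (∂S_ν/∂q^a) = 0 and Σ_b [ (∂S_ν/∂q^b) ∂/∂q^b (∂S_μ/∂q^a)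 − (∂S_μ/∂q^b) ∂/∂q^b (∂S_ν/∂q^a) ] = 0. -/
noncomputable section

/-- The Minkowski metric `η = diag(1,-1,-1,-1)` on `ℝ⁴`. -/
def mink (μ ν : Fin 4) : ℝ := if μ = ν then (if μ = 0 then 1 else -1) else 0

/-- The Minkowski bilinear form on `ℝ⁴`. -/
def etaBil (v w : Fin 4 → ℝ) : ℝ := ∑ μ, ∑ ν, mink μ ν * v μ * w ν

/-- Partial derivative in `σ` of a function of `(σ,q) ∈ ℝ × ℝⁿ`. -/
def pds {n : ℕ} (F : ℝ → (Fin n → ℝ) → ℝ) : ℝ → (Fin n → ℝ) → ℝ :=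
  fun σ q => deriv (fun s => F s q) σ

/-- Partial derivative in `q^a` of a function of `(σ,q) ∈ ℝ × ℝⁿ`. -/
def pdqs {n : ℕ} (a : Fin n) (F : ℝ → (Fin n → ℝ) → ℝ) : ℝ → (Fin n → ℝ) → ℝ :=
  fun σ q => fderiv ℝ (fun p => F σ p) q (Pi.single a 1)

/-- Partial derivative in `x^μ` of a function on `ℝ⁴ × ℝⁿ`. -/
def pdx {n : ℕ} (μ : Fin 4) (F : (Fin 4 → ℝ) → (Fin n → ℝ) → ℝ) :
    (Fin 4 → ℝ) → (Fin n → ℝ) → ℝ :=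
  fun x q => fderiv ℝ (fun y => F y q) x (Pi.single μ 1)

/-- Partial derivative in `q^a` of a function on `ℝ⁴ × ℝⁿ`. -/
def pdq {n : ℕ} (a : Fin n) (F : (Fin 4 → ℝ) → (Fin n → ℝ) → ℝ) :
    (Fin 4 → ℝ) → (Fin n → ℝ) → ℝ :=
  fun x q => fderiv ℝ (fun p => F x p) q (Pi.single a 1)

theorem etaBil_eq_sum (v w : Fin 4 → ℝ) :
    etaBil v w = ∑ ν, (∑ μ, mink ν μ * v μ) * w ν := by
  simp only [etaBil, mink, Fin.sum_univ_four]
  simp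

theorem hasFDerivAt_etaBil (v x : Fin 4 → ℝ) :
    HasFDerivAt (etaBil v)
      (∑ ν, (∑ μ, mink ν μ * v μ) • ContinuousLinearMap.proj (R := ℝ) (φ := fun _ => ℝ) ν) x := by
  have h : etaBil v = fun w => ∑ ν, (∑ μ, mink ν μ * v μ) * w ν :=
    funext fun w => etaBil_eq_sum v w
  rw [h]
  exact HasFDerivAt.fun_sum fun ν _ => (hasFDerivAt_apply ν x).const_mul _

theorem pdx_comp_etaBil_mul_const {n : ℕ} {F : ℝ → (Fin n → ℝ) → ℝ} (v x : Fin 4 → ℝ)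
    (q : Fin n → ℝ) (hF : DifferentiableAt ℝ (fun s => F s q) (etaBil v x)) (c : ℝ) (μ : Fin 4) :
    pdx μ (fun y p => F (etaBil v y) p * c) x q =
      pds F (etaBil v x) q * (∑ ν, mink μ ν * v ν) * c := by
  have h := (hF.hasDerivAt.comp_hasFDerivAt x (hasFDerivAt_etaBil v x)).mul_const c
  have h' : HasFDerivAt (fun y => F (etaBil v y) q * c) _ x := h
  simp only [pdx, pds, h'.fderiv]
  simp [Pi.single_apply]
  ring

theorem pdq_comp_etaBil_mul_const {n : ℕ} {F : ℝ → (Fin n → ℝ) → ℝ} (v x : Fin 4 → ℝ)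
    (q : Fin n → ℝ) (hF : DifferentiableAt ℝ (F (etaBil v x)) q) (c : ℝ) (a : Fin n) :
    pdq a (fun y p => F (etaBil v y) p * c) x q = pdqs a F (etaBil v x) q * c := by
  have h : HasFDerivAt (fun p => F (etaBil v x) p * c) _ q := hF.hasFDerivAt.mul_const c
  simp only [pdq, pdqs, h.fderiv]
  simp [mul_comm]

theorem contDiff_pdqs {n : ℕ} {F : ℝ → (Fin n → ℝ) → ℝ}
    (hF : ContDiff ℝ (⊤ : ℕ∞) (fun p : ℝ × (Fin n → ℝ) => F p.1 p.2)) (a : Fin n) :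
    ContDiff ℝ (⊤ : ℕ∞) (fun p : ℝ × (Fin n → ℝ) => pdqs a F p.1 p.2) := by
  have h : ContDiff ℝ (⊤ : ℕ∞) (fun p : (ℝ × (Fin n → ℝ)) × (Fin n → ℝ) => F p.1.1 p.2) :=
    hF.comp (contDiff_fst.fst.prodMk contDiff_snd)
  exact (ContDiff.fderiv h contDiff_snd (by simp)).clm_apply contDiff_const

theorem differentiable_fst_of_contDiff {n : ℕ} {F : ℝ → (Fin n → ℝ) → ℝ}
    (hF : ContDiff ℝ (⊤ : ℕ∞) (fun p : ℝ × (Fin n → ℝ) => F p.1 p.2)) (q : Fin n → ℝ) :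
    Differentiable ℝ (fun s => F s q) :=
  (hF.differentiable (by simp)).comp (differentiable_id.prodMk (differentiable_const q))

theorem differentiable_snd_of_contDiff {n : ℕ} {F : ℝ → (Fin n → ℝ) → ℝ}
    (hF : ContDiff ℝ (⊤ : ℕ∞) (fun p : ℝ × (Fin n → ℝ) => F p.1 p.2)) (s : ℝ) :
    Differentiable ℝ (F s) :=
  (hF.differentiable (by simp)).comp ((differentiable_const s).prodMk differentiable_id)

/-- Plane-wave solutions of the DeDonder–Weyl–Christodoulou system: if `(f,g)` solves the
classical Hamilton–Jacobi and continuity equations in `(σ,q)`, and `n` is a unit timelike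
vector, then `S^μ(x,q) = f(η(n,x),q) n^μ` and `ρ(x,q) = g(η(n,x),q)` solve (i) the
DeDonder–Weyl Hamilton–Jacobi equation, (ii) the continuity equations, and (iii) the
integrability conditions. -/
theorem plane_wave_solves_DWC {n : ℕ}
    (nv : Fin 4 → ℝ) (hnv : etaBil nv nv = 1)
    (nlow : Fin 4 → ℝ) (hnlow : ∀ μ, nlow μ = ∑ ν, mink μ ν * nv ν)
    (V : (Fin n → ℝ) → ℝ) (hV : ContDiff ℝ (⊤ : ℕ∞) V)
    (f g : ℝ → (Fin n → ℝ) → ℝ)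
    (hf : ContDiff ℝ (⊤ : ℕ∞) (fun p : ℝ × (Fin n → ℝ) => f p.1 p.2))
    (hg : ContDiff ℝ (⊤ : ℕ∞) (fun p : ℝ × (Fin n → ℝ) => g p.1 p.2))
    (hHJ : ∀ σ q, pds f σ q + (1/2) * (∑ a, (pdqs a f σ q) ^ 2) + V q = 0)
    (hCont : ∀ σ q, pds g σ q
        + (∑ a, pdqs a (fun s p => g s p * pdqs a f s p) σ q) = 0)
    (S : (Fin 4 → ℝ) → (Fin n → ℝ) → Fin 4 → ℝ)
    (hS : ∀ x q μ, S x q μ = f (etaBil nv x) q * nv μ)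
    (Slow : (Fin 4 → ℝ) → (Fin n → ℝ) → Fin 4 → ℝ)
    (hSlow : ∀ x q μ, Slow x q μ = f (etaBil nv x) q * nlow μ)
    (ρ : (Fin 4 → ℝ) → (Fin n → ℝ) → ℝ)
    (hρ : ∀ x q, ρ x q = g (etaBil nv x) q) :
    -- (i) DeDonder--Weyl Hamilton--Jacobi equation
    (∀ x q, (∑ μ, pdx μ (fun y p => S y p μ) x q)
        + (1/2) * (∑ a, ∑ μ, ∑ ν, mink μ ν
            * pdq a (fun y p => S y p μ) x q * pdq a (fun y p => S y p ν) x q)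
        + V q = 0) ∧
    -- (ii) continuity equations
    (∀ μ x q, pdx μ ρ x q
        + (∑ a, pdq a (fun y p => ρ y p * pdq a (fun z r => Slow z r μ) y p) x q) = 0) ∧
    -- (iii) integrability conditions
    (∀ (a : Fin n) (μ ν : Fin 4) x q,
        pdx ν (fun y p => pdq a (fun z r => Slow z r μ) y p) x q
          - pdx μ (fun y p => pdq a (fun z r => Slow z r ν) y p) x q = 0) ∧
    (∀ (a : Fin n) (μ ν : Fin 4) x q,
        (∑ b, (pdq b (fun z r => Slow z r ν) x q
                * pdq b (fun y p => pdq a (fun z r => Slow z r μ) y p) x q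
              - pdq b (fun z r => Slow z r μ) x q
                * pdq b (fun y p => pdq a (fun z r => Slow z r ν) y p) x q)) = 0) := by
  have hnorm : ∑ μ, (∑ ν, mink μ ν * nv ν) * nv μ = 1 := by rw [← etaBil_eq_sum, hnv]
  have pdq_f (c : ℝ) (a : Fin n) (x : Fin 4 → ℝ) (q : Fin n → ℝ) :
      pdq a (fun y p => f (etaBil nv y) p * c) x q = pdqs a f (etaBil nv x) q * c :=
    pdq_comp_etaBil_mul_const nv x q (differentiable_snd_of_contDiff hf _ q) c a
  have pdx_pdqs_f (c : ℝ) (a : Fin n) (μ : Fin 4) (x : Fin 4 → ℝ) (q : Fin n → ℝ) :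
      pdx μ (fun y p => pdqs a f (etaBil nv y) p * c) x q =
        pds (pdqs a f) (etaBil nv x) q * (∑ ν, mink μ ν * nv ν) * c :=
    pdx_comp_etaBil_mul_const nv x q
      (differentiable_fst_of_contDiff (contDiff_pdqs hf a) q _) c μ
  have pdq_pdqs_f (c : ℝ) (a b : Fin n) (x : Fin 4 → ℝ) (q : Fin n → ℝ) :
      pdq b (fun y p => pdqs a f (etaBil nv y) p * c) x q =
        pdqs b (pdqs a f) (etaBil nv x) q * c :=
    pdq_comp_etaBil_mul_const nv x q
      (differentiable_snd_of_contDiff (contDiff_pdqs hf a) _ q) c b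
  simp only [hS, hSlow, pdq_f, pdx_pdqs_f, pdq_pdqs_f]
  refine ⟨fun x q => ?_, fun μ x q => ?_, fun a μ ν x q => ?_, fun a μ ν x q => ?_⟩
  · have hdiv : ∑ μ, pdx μ (fun y p => f (etaBil nv y) p * nv μ) x q =
        pds f (etaBil nv x) q := by
      simp only [pdx_comp_etaBil_mul_const nv x q (differentiable_fst_of_contDiff hf q _)]
      simp only [mul_assoc (pds f _ _), ← Finset.mul_sum, hnorm, mul_one]
    have hquad (d : ℝ) : ∑ μ, ∑ ν, mink μ ν * (d * nv μ) * (d * nv ν) = d ^ 2 := by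
      calc _ = d ^ 2 * etaBil nv nv := by
            simp only [etaBil, Finset.mul_sum]
            exact Finset.sum_congr rfl fun μ _ => Finset.sum_congr rfl fun ν _ => by ring
        _ = d ^ 2 := by rw [hnv, mul_one]
    simp only [hdiv, hquad]
    exact hHJ _ q
  · have hρ' : ρ = fun y p => g (etaBil nv y) p * 1 := by
      funext y p
      rw [hρ, mul_one]
    have hflux (a : Fin n) :
        pdq a (fun y p => ρ y p * (pdqs a f (etaBil nv y) p * nlow μ)) x q =
          pdqs a (fun s p => g s p * pdqs a f s p) (etaBil nv x) q * nlow μ := by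
      simp only [hρ, ← mul_assoc]
      exact pdq_comp_etaBil_mul_const (F := fun s p => g s p * pdqs a f s p) nv x q
        (differentiable_snd_of_contDiff (F := fun s p => g s p * pdqs a f s p)
          (hg.mul (contDiff_pdqs hf a)) _ q) _ a
    simp only [hflux]
    rw [hρ', pdx_comp_etaBil_mul_const nv x q (differentiable_fst_of_contDiff hg q _), ← hnlow,
      ← Finset.sum_mul]
    linear_combination nlow μ * hCont (etaBil nv x) q
  · simp only [← hnlow]
    ring
  · exact Finset.sum_eq_zero fun b _ => by ring
end
end

section
/- Let a > 0, m > 0, let V : ℝ × ℝ³ → ℝ be smooth, and let ρ : ℝ × ℝ³ → (0,∞) and S : ℝ × ℝ³ → ℝ be smooth. Define ψ := √ρ · e^{iS/a}. Then (ρ,S) satisfies the classical Hamilton–Jacobi equation ∂_t S + (1/(2m)) |∇_q S|² + V = 0 together with the continuity equation ∂_t ρ + ∇_q · ( ρ (1/m) ∇_q S ) = 0 if and only if ψ satisfies the nonlinear Schrödinger-type equation i a ∂_t ψ = −(a²/(2m)) Δ_q ψ + V ψ + (a²/(2m)) (Δ_q |ψ| / |ψ|) ψ, where |ψ| = √ρ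 > 0. -/
noncomputable section

/-- Partial derivative in `t` of a real-valued function of `(t,q) ∈ ℝ × ℝ³`. -/
def pdtR (F : ℝ → (Fin 3 → ℝ) → ℝ) : ℝ → (Fin 3 → ℝ) → ℝ :=
  fun t q => deriv (fun s => F s q) t

/-- Partial derivative in `q^k` of a real-valued function of `(t,q) ∈ ℝ × ℝ³`. -/
def pdqR (k : Fin 3) (F : ℝ → (Fin 3 → ℝ) → ℝ) : ℝ → (Fin 3 → ℝ) → ℝ :=
  fun t q => fderiv ℝ (fun p => F t p) q (Pi.single k 1)

/-- Partial derivative in `q^k` of a complex-valued function of `(t,q) ∈ ℝ × ℝ³`. -/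
def pdqC (k : Fin 3) (F : ℝ → (Fin 3 → ℝ) → ℂ) : ℝ → (Fin 3 → ℝ) → ℂ :=
  fun t q => fderiv ℝ (fun p => F t p) q (Pi.single k 1)

section DirectionalDerivatives

variable {E : Type*} [NormedAddCommGroup E] [NormedSpace ℝ E]

theorem fderiv_ofReal_comp_apply {f : E → ℝ} {x : E} (hf : DifferentiableAt ℝ f x) (v : E) :
    fderiv ℝ (fun y => (f y : ℂ)) x v = (fderiv ℝ f x v : ℂ) := by
  have h := Complex.ofRealCLM.hasFDerivAt.comp x hf.hasFDerivAt
  exact congrArg (fun L : E →L[ℝ] ℂ => L v) h.fderiv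

theorem fderiv_mul_cexp_phase_apply {A : E → ℂ} {S : E → ℝ} {x : E} (a : ℝ)
    (hA : DifferentiableAt ℝ A x) (hS : DifferentiableAt ℝ S x) (v : E) :
    fderiv ℝ (fun y => A y * Complex.exp (Complex.I * (S y : ℂ) / (a : ℂ))) x v
      = (fderiv ℝ A x v + A x * (Complex.I * (fderiv ℝ S x v : ℂ) / (a : ℂ)))
        * Complex.exp (Complex.I * (S x : ℂ) / (a : ℂ)) := by
  have hSC : HasFDerivAt (fun y => (S y : ℂ)) (Complex.ofRealCLM.comp (fderiv ℝ S x)) x :=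
    Complex.ofRealCLM.hasFDerivAt.comp x hS.hasFDerivAt
  have hphase := ((hSC.const_mul Complex.I).mul_const ((a : ℂ)⁻¹)).cexp
  have h := (hA.hasFDerivAt.mul hphase).fderiv
  simp only [div_eq_mul_inv]
  rw [show (fun y => A y * Complex.exp (Complex.I * (S y : ℂ) * (a : ℂ)⁻¹))
    = A * fun y => Complex.exp (Complex.I * (S y : ℂ) * (a : ℂ)⁻¹) from rfl, h]
  simp
  ring

/-- The second derivative along `v` of a function in polar form. -/
theorem fderiv_fderiv_polar_apply {R S : E → ℝ} (a : ℝ)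
    (hR : ContDiff ℝ (⊤ : ℕ∞) R) (hS : ContDiff ℝ (⊤ : ℕ∞) S) (v x : E) :
    fderiv ℝ (fun z => fderiv ℝ
        (fun y => (R y : ℂ) * Complex.exp (Complex.I * (S y : ℂ) / (a : ℂ))) z v) x v
      = ((fderiv ℝ (fun z => fderiv ℝ R z v) x v : ℂ)
          + 2 * (fderiv ℝ R x v : ℂ) * (Complex.I * (fderiv ℝ S x v : ℂ) / (a : ℂ))
          + R x * (Complex.I * (fderiv ℝ (fun z => fderiv ℝ S z v) x v : ℂ) / (a : ℂ))
          + R x * (Complex.I * (fderiv ℝ S x v : ℂ) / (a : ℂ)) ^ 2)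
        * Complex.exp (Complex.I * (S x : ℂ) / (a : ℂ)) := by
  have dR : Differentiable ℝ R := hR.differentiable (by simp)
  have dS : Differentiable ℝ S := hS.differentiable (by simp)
  have dR' : Differentiable ℝ (fun z => fderiv ℝ R z v) :=
    ((hR.fderiv_right (m := 1) (by norm_cast)).clm_apply contDiff_const).differentiable (by simp)
  have dS' : Differentiable ℝ (fun z => fderiv ℝ S z v) :=
    ((hS.fderiv_right (m := 1) (by norm_cast)).clm_apply contDiff_const).differentiable (by simp)
  have ofReal_diff {f : E → ℝ} (hf : Differentiable ℝ f) :
      Differentiable ℝ (fun y => (f y : ℂ)) :=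
    Complex.ofRealCLM.differentiable.comp hf
  have hphase := ((ofReal_diff dS').const_mul Complex.I).mul_const ((a : ℂ)⁻¹)
  simp only [← div_eq_mul_inv] at hphase
  simp_rw [fun z => fderiv_mul_cexp_phase_apply a (ofReal_diff dR z) (dS z) v,
    fun z => fderiv_ofReal_comp_apply (dR z) v]
  rw [fderiv_mul_cexp_phase_apply a
    (((ofReal_diff dR').fun_add ((ofReal_diff dR).fun_mul hphase)) x) (dS x) v]
  have hderiv : fderiv ℝ (fun y => (fderiv ℝ R y v : ℂ)
      + (R y : ℂ) * (Complex.I * (fderiv ℝ S y v : ℂ) / (a : ℂ))) x v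
      = (fderiv ℝ (fun z => fderiv ℝ R z v) x v : ℂ)
        + ((fderiv ℝ R x v : ℂ) * (Complex.I * (fderiv ℝ S x v : ℂ) / (a : ℂ))
        + R x * (Complex.I * (fderiv ℝ (fun z => fderiv ℝ S z v) x v : ℂ) / (a : ℂ))) := by
    rw [fderiv_fun_add ((ofReal_diff dR') x) (((ofReal_diff dR).fun_mul hphase) x),
      fderiv_fun_mul ((ofReal_diff dR) x) (hphase x)]
    simp only [div_eq_mul_inv]
    rw [fderiv_mul_const (((ofReal_diff dS').const_mul Complex.I) x),
      fderiv_const_mul ((ofReal_diff dS') x)]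
    simp only [add_apply, smul_apply, smul_eq_mul,
      fderiv_ofReal_comp_apply (dR' x), fderiv_ofReal_comp_apply (dS' x),
      fderiv_ofReal_comp_apply (dR x)]
    ring
  rw [hderiv]
  ring

/-- The divergence term of the continuity equation in terms of the amplitude `R = √ρ`. -/
theorem fderiv_sq_mul_fderiv_apply {R S : E → ℝ} (c : ℝ)
    (hR : ContDiff ℝ (⊤ : ℕ∞) R) (hS : ContDiff ℝ (⊤ : ℕ∞) S) (v x : E) :
    fderiv ℝ (fun y => R y ^ 2 * (c * fderiv ℝ S y v)) x v
      = c * R x * (2 * fderiv ℝ R x v * fderiv ℝ S x v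
        + R x * fderiv ℝ (fun z => fderiv ℝ S z v) x v) := by
  have dR : DifferentiableAt ℝ R x := hR.differentiable (by simp) x
  have dS' : DifferentiableAt ℝ (fun z => fderiv ℝ S z v) x :=
    ((hS.fderiv_right (m := 1) (by norm_cast)).clm_apply contDiff_const).differentiable
      (by simp) x
  rw [fderiv_fun_mul (dR.fun_pow 2) (dS'.const_mul c), fderiv_fun_pow 2 dR, fderiv_const_mul dS']
  simp
  ring

end DirectionalDerivatives

/-- The real and imaginary parts of the Schrödinger equation after dividing by the phase. -/
theorem polar_schrodinger_iff {a m R : ℝ} (ha : 0 < a) (hm : 0 < m) (hR : 0 < R)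
    (Rt St V : ℝ) (DR DS D2R D2S : Fin 3 → ℝ) {e : ℂ} (he : e ≠ 0) :
    Complex.I * (a : ℂ) * (((Rt : ℂ) + R * (Complex.I * (St : ℂ) / (a : ℂ))) * e)
        = -((a : ℂ) ^ 2 / (2 * (m : ℂ))) * (∑ k, ((D2R k : ℂ)
            + 2 * (DR k : ℂ) * (Complex.I * (DS k : ℂ) / (a : ℂ))
            + R * (Complex.I * (D2S k : ℂ) / (a : ℂ))
            + R * (Complex.I * (DS k : ℂ) / (a : ℂ)) ^ 2) * e)
          + (V : ℂ) * (R * e)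
          + ((a : ℂ) ^ 2 / (2 * (m : ℂ))) * (((∑ k, D2R k) / R : ℝ) : ℂ) * (R * e)
    ↔ St + (1 / (2 * m)) * (∑ k, DS k ^ 2) + V = 0 ∧
      2 * R * Rt + ∑ k, 1 / m * R * (2 * DR k * DS k + R * D2S k) = 0 := by
  have haC : (a : ℂ) ≠ 0 := by exact_mod_cast ha.ne'
  have hmC : (m : ℂ) ≠ 0 := by exact_mod_cast hm.ne'
  have hRC : (R : ℂ) ≠ 0 := by exact_mod_cast hR.ne'
  rw [← sub_eq_zero]
  have residual : ∀ H C : ℝ, H = St + (1 / (2 * m)) * (∑ k, DS k ^ 2) + V →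
      C = 2 * R * Rt + ∑ k, 1 / m * R * (2 * DR k * DS k + R * D2S k) →
      Complex.I * (a : ℂ) * (((Rt : ℂ) + R * (Complex.I * (St : ℂ) / (a : ℂ))) * e)
        - (-((a : ℂ) ^ 2 / (2 * (m : ℂ))) * (∑ k, ((D2R k : ℂ)
            + 2 * (DR k : ℂ) * (Complex.I * (DS k : ℂ) / (a : ℂ))
            + R * (Complex.I * (D2S k : ℂ) / (a : ℂ))
            + R * (Complex.I * (DS k : ℂ) / (a : ℂ)) ^ 2) * e)
          + (V : ℂ) * (R * e)
          + ((a : ℂ) ^ 2 / (2 * (m : ℂ))) * (((∑ k, D2R k) / R : ℝ) : ℂ) * (R * e))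
        = (((-(R * H) : ℝ) : ℂ) + ((a / (2 * R) * C : ℝ) : ℂ) * Complex.I) * e := by
    rintro H C rfl rfl
    simp only [Fin.sum_univ_three]
    push_cast
    field_simp
    ring_nf
    simp only [Complex.I_sq]
    ring
  have parts : ∀ x y : ℝ, (x : ℂ) + y * Complex.I = 0 ↔ x = 0 ∧ y = 0 := by
    simp [Complex.ext_iff]
  have hcoef : a / (2 * R) ≠ 0 := by positivity
  rw [residual _ _ rfl rfl, mul_eq_zero, or_iff_left he, parts, neg_eq_zero,
    mul_eq_zero_iff_left hR.ne', mul_eq_zero_iff_left hcoef]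

/-- For `a > 0`, `m > 0`, smooth `V`, `ρ > 0` and `S` smooth, and `ψ = √ρ e^{iS/a}`:
`(ρ,S)` satisfies the classical Hamilton–Jacobi and continuity equations if and only if
`ψ` satisfies the nonlinear Schrödinger-type equation
`ia ∂_t ψ = −(a²/2m) Δ_q ψ + V ψ + (a²/2m)(Δ_q|ψ|/|ψ|) ψ`, where `|ψ| = √ρ`. -/
theorem classical_HJ_iff_nonlinear_schrodinger
    (a m : ℝ) (ha : 0 < a) (hm : 0 < m)
    (V :  ℝ → (Fin 3 → ℝ) → ℝ)
    (hV : ContDiff ℝ (⊤ : ℕ∞) (fun p : ℝ × (Fin 3 → ℝ) => V p.1 p.2))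
    (ρ S : ℝ → (Fin 3 → ℝ) → ℝ)
    (hρpos : ∀ t q, 0 < ρ t q)
    (hρ : ContDiff ℝ (⊤ : ℕ∞) (fun p : ℝ × (Fin 3 → ℝ) => ρ p.1 p.2))
    (hS : ContDiff ℝ (⊤ : ℕ∞) (fun p : ℝ × (Fin 3 → ℝ) => S p.1 p.2))
    (ψ : ℝ → (Fin 3 → ℝ) → ℂ)
    (hψ : ∀ t q, ψ t q = ((Real.sqrt (ρ t q) : ℝ) : ℂ)
        * Complex.exp (Complex.I * ((S t q : ℝ) : ℂ) / (a : ℂ))) :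
    ((∀ t q, pdtR S t q + (1 / (2 * m)) * (∑ k, (pdqR k S t q) ^ 2) + V t q = 0) ∧
     (∀ t q, pdtR ρ t q
        + (∑ k, pdqR k (fun s p => ρ s p * ((1 / m) * pdqR k S s p)) t q) = 0))
    ↔
    (∀ t q, Complex.I * (a : ℂ) * deriv (fun s => ψ s q) t
        = -((a : ℂ) ^ 2 / (2 * (m : ℂ))) * (∑ k, pdqC k (pdqC k ψ) t q)
          + ((V t q : ℝ) : ℂ) * ψ t q
          + ((a : ℂ) ^ 2 / (2 * (m : ℂ)))
            * ((((∑ k, pdqR k (pdqR k (fun s p => Real.sqrt (ρ s p))) t q)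
                  / Real.sqrt (ρ t q) : ℝ)) : ℂ) * ψ t q) := by
  have hRjoint : ContDiff ℝ (⊤ : ℕ∞)
      (fun p : ℝ × (Fin 3 → ℝ) => Real.sqrt (ρ p.1 p.2)) :=
    hρ.sqrt fun p => (hρpos p.1 p.2).ne'
  have hRq (t : ℝ) : ContDiff ℝ (⊤ : ℕ∞) (fun q => Real.sqrt (ρ t q)) :=
    hRjoint.comp (contDiff_const.prodMk contDiff_id)
  have hSq (t : ℝ) : ContDiff ℝ (⊤ : ℕ∞) (S t) :=
    hS.comp (contDiff_const.prodMk contDiff_id)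
  have hRt (q : Fin 3 → ℝ) : Differentiable ℝ (fun s => Real.sqrt (ρ s q)) :=
    (hRjoint.comp (contDiff_id.prodMk contDiff_const)).differentiable (by simp)
  have hSt (q : Fin 3 → ℝ) : Differentiable ℝ (fun s => S s q) :=
    (hS.comp (contDiff_id.prodMk contDiff_const)).differentiable (by simp)
  have hψ' : ψ = fun t q => ((Real.sqrt (ρ t q) : ℝ) : ℂ)
      * Complex.exp (Complex.I * ((S t q : ℝ) : ℂ) / (a : ℂ)) :=
    funext fun t => funext fun q => hψ t q
  have hsq (t : ℝ) (q : Fin 3 → ℝ) : ρ t q = Real.sqrt (ρ t q) ^ 2 :=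
    (Real.sq_sqrt (hρpos t q).le).symm
  have hρt (t : ℝ) (q : Fin 3 → ℝ) :
      pdtR ρ t q = 2 * Real.sqrt (ρ t q) * deriv (fun s => Real.sqrt (ρ s q)) t := by
    have h := deriv_fun_pow (hRt q t) 2
    simp only [← hsq] at h
    simpa [pdtR] using h
  have hdiv (t : ℝ) (q : Fin 3 → ℝ) (k : Fin 3) :
      pdqR k (fun s p => ρ s p * ((1 / m) * pdqR k S s p)) t q
        = 1 / m * Real.sqrt (ρ t q) *
          (2 * pdqR k (fun s p => Real.sqrt (ρ s p)) t q * pdqR k S t q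
            + Real.sqrt (ρ t q) * pdqR k (pdqR k S) t q) := by
    have h := fderiv_sq_mul_fderiv_apply (1 / m) (hRq t) (hSq t) (Pi.single k 1) q
    simp only [← hsq] at h
    exact h
  have hψt (t : ℝ) (q : Fin 3 → ℝ) : deriv (fun s => ψ s q) t
      = (((deriv (fun s => Real.sqrt (ρ s q)) t : ℝ) : ℂ)
          + Real.sqrt (ρ t q) * (Complex.I * (pdtR S t q : ℂ) / (a : ℂ)))
        * Complex.exp (Complex.I * ((S t q : ℝ) : ℂ) / (a : ℂ)) := by
    have h := fderiv_mul_cexp_phase_apply a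
      (Complex.ofRealCLM.differentiable.comp (hRt q) t) (hSt q t) 1
    have h' := fderiv_ofReal_comp_apply (hRt q t) 1
    simp only [fderiv_apply_one_eq_deriv] at h h'
    rw [hψ', ← h']
    exact h
  have hψq (t : ℝ) (q : Fin 3 → ℝ) (k : Fin 3) : pdqC k (pdqC k ψ) t q
      = ((pdqR k (pdqR k (fun s p => Real.sqrt (ρ s p))) t q : ℂ)
          + 2 * (pdqR k (fun s p => Real.sqrt (ρ s p)) t q : ℂ)
            * (Complex.I * (pdqR k S t q : ℂ) / (a : ℂ))
          + Real.sqrt (ρ t q) * (Complex.I * (pdqR k (pdqR k S) t q : ℂ) / (a : ℂ))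
          + Real.sqrt (ρ t q) * (Complex.I * (pdqR k S t q : ℂ) / (a : ℂ)) ^ 2)
        * Complex.exp (Complex.I * ((S t q : ℝ) : ℂ) / (a : ℂ)) := by
    rw [hψ']
    exact fderiv_fderiv_polar_apply a (hRq t) (hSq t) (Pi.single k 1) q
  rw [← forall_and]
  refine forall_congr' fun t => ?_
  rw [← forall_and]
  refine forall_congr' fun q => ?_
  rw [hψt, hρt, hψ]
  simp_rw [hdiv, hψq]
  exact (polar_schrodinger_iff ha hm (Real.sqrt_pos.2 (hρpos t q)) _ _ _ _ _ _ _
    (Complex.exp_ne_zero _)).symm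
end
end
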